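/- Let k be a field of characteristic p > 0, n ≥ 1, and A = k[x_1,…,x_n]. Then the union ⋃_{r ≥ 0} End_{A_r}(A), taken inside End_k(A) with A_r = k[x_1^{p^r},…,x_n^{p^r}], equals the Weyl algebra A_n(k), i.e., the k-subalgebra of End_k(A) generated by the multiplication operators by x_1,…,x_n together with all divided power operators ∂_i^[s] for 1 ≤ i ≤ n and s ≥ 1. -/

import Mathlib

/-- The divided power operator `∂_i^[r]` on `k[x_1,…,x_n]`, the `k`-linear map determined on
monomials by `∂_i^[r](x^m) = C(m_i, r) • x^(m - r·ε_i)` (zero when `m_i < r`). -/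
noncomputable def dividedPower (k : Type*) [Field k] (n : ℕ) (i : Fin n) (r : ℕ) :
    Module.End k (MvPolynomial (Fin n) k) :=
  (MvPolynomial.basisMonomials (Fin n) k).constr k fun m =>
    ((m i).choose r : k) • MvPolynomial.monomial (m - Finsupp.single i r) 1

/-- The Weyl algebra `A_n(k)`, the `k`-subalgebra of `End_k(k[x_1,…,x_n])` generated by the
multiplication operators by `x_1,…,x_n` together with all divided powers `∂_i^[r]`, `r ≥ 1`. -/
noncomputable def weylAlgebra (k : Type*) [Field k] (n : ℕ) :
    Subalgebra k (Module.End k (MvPolynomial (Fin n) k)) :=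
  Algebra.adjoin k
    ((Set.range fun i : Fin n => (LinearMap.mulLeft k (MvPolynomial.X i) :
        Module.End k (MvPolynomial (Fin n) k))) ∪
      {f | ∃ (i : Fin n) (r : ℕ), 1 ≤ r ∧ f = dividedPower k n i r})

/-- A ring is left coherent if every finitely generated left ideal is finitely presented. -/
def IsLeftCoherent (R : Type*) [Ring R] : Prop :=
  ∀ I : Ideal R, I.FG → Module.FinitePresentation R I

/-- A ring is right coherent if every finitely generated right ideal is finitely presented. -/
def IsRightCoherent (R : Type*) [Ring R] : Prop :=
  ∀ I : Ideal Rᵐᵒᵖ, I.FG → Module.FinitePresentation Rᵐᵒᵖ I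

/-- The subalgebra `A_r = k[x_1^{p^r},…,x_n^{p^r}]` of `A = k[x_1,…,x_n]`. -/
noncomputable def subAr (k : Type*) [Field k] (n p r : ℕ) :
    Subalgebra k (MvPolynomial (Fin n) k) :=
  Algebra.adjoin k (Set.range fun i : Fin n => MvPolynomial.X i ^ p ^ r)

/-- The ring `D_r = End_{A_r}(A)` of `A_r`-module endomorphisms of `A`, viewed as the subring of
`End_k(A)` of endomorphisms commuting with multiplication by elements of `A_r`. -/
noncomputable def endAr (k : Type*) [Field k] (n p r : ℕ) :
    Subring (Module.End k (MvPolynomial (Fin n) k)) :=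
  Subring.centralizer
    ((fun b => (LinearMap.mulLeft k b : Module.End k (MvPolynomial (Fin n) k))) ''
      (subAr k n p r : Set (MvPolynomial (Fin n) k)))


/-- In characteristic `p`, the binomial coefficient `C(a, s)` with `s < p ^ r` depends only on
`a` modulo `p ^ r`. -/
theorem cast_choose_add_pow_char {k : Type*} [Field k] {p : ℕ} [CharP k p] (hp : p.Prime)
    {r s : ℕ} (hs : s < p ^ r) (a : ℕ) :
    ((p ^ r + a).choose s : k) = (a.choose s : k) := by
  rw [Nat.add_choose_eq, Nat.cast_sum, Finset.sum_eq_single (0, s)]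
  · simp
  · rintro ⟨i, j⟩ hij hne
    have hij : i + j = s := by simpa using hij
    have hi : i ≠ 0 := by
      rintro rfl
      simp_all
    have hdvd : p ∣ (p ^ r).choose i := hp.dvd_choose_pow hi (by omega)
    simp [(CharP.cast_eq_zero_iff k p _).2 hdvd]
  · simp

theorem dividedPower_monomial (k : Type*) [Field k] (n : ℕ) (i : Fin n) (s : ℕ)
    (m : Fin n →₀ ℕ) :
    dividedPower k n i s (MvPolynomial.monomial m 1) =
      ((m i).choose s : k) • MvPolynomial.monomial (m - Finsupp.single i s) 1 := by
  have h := (MvPolynomial.basisMonomials (Fin n) k).constr_basis k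
    (fun m => ((m i).choose s : k) •
      (MvPolynomial.monomial (m - Finsupp.single i s) 1 : MvPolynomial (Fin n) k)) m
  rwa [MvPolynomial.coe_basisMonomials] at h

theorem list_prod_dividedPower_monomial (k : Type*) [Field k] (n s : ℕ) (l : List (Fin n))
    (hl : l.Nodup) (m : Fin n →₀ ℕ) :
    (l.map fun i => dividedPower k n i s).prod (MvPolynomial.monomial m 1) =
      (l.map fun i => ((m i).choose s : k)).prod •
        MvPolynomial.monomial (m - (l.map fun i => Finsupp.single i s).sum) 1 := by
  induction l with
  | nil => simp
  | cons i l ih =>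
    obtain ⟨hi, hl'⟩ := List.nodup_cons.1 hl
    have h0 : (l.map fun j => Finsupp.single j s).sum i = 0 := by
      clear ih hl' hl
      induction l with
      | nil => simp
      | cons j l ih =>
        rw [List.mem_cons, not_or] at hi
        simp [ih hi.2, Ne.symm hi.1]
    simp only [List.map_cons, List.prod_cons, List.sum_cons, Module.End.mul_apply, ih hl', map_smul,
      dividedPower_monomial, smul_smul, Finsupp.tsub_apply, h0, tsub_zero]
    rw [mul_comm, add_comm, tsub_add_eq_tsub_tsub]

theorem mem_endAr_iff {k : Type*} [Field k] {n p r : ℕ}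
    {f : Module.End k (MvPolynomial (Fin n) k)} :
    f ∈ endAr k n p r ↔ ∀ b ∈ subAr k n p r, ∀ a, f (b * a) = b * f a := by
  simp only [endAr, Subring.mem_centralizer_iff, Set.forall_mem_image, SetLike.mem_coe,
    LinearMap.ext_iff, Module.End.mul_apply, LinearMap.mulLeft_apply, eq_comm]

theorem mem_endAr_of_X_pow {k : Type*} [Field k] {n p r : ℕ}
    {f : Module.End k (MvPolynomial (Fin n) k)}
    (h : ∀ i a, f (MvPolynomial.X i ^ p ^ r * a) = MvPolynomial.X i ^ p ^ r * f a) :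
    f ∈ endAr k n p r := by
  refine mem_endAr_iff.2 fun b hb => ?_
  induction hb using Algebra.adjoin_induction with
  | mem x hx =>
    obtain ⟨i, rfl⟩ := hx
    exact h i
  | algebraMap c => intro a; rw [← Algebra.smul_def, ← Algebra.smul_def, map_smul]
  | add x y _ _ hx hy => intro a; simp [add_mul, hx, hy]
  | mul x y _ _ hx hy => intro a; rw [mul_assoc, hx, hy, mul_assoc]

theorem endAr_mono (k : Type*) [Field k] (n p : ℕ) : Monotone (endAr k n p) := by
  intro r s hrs f hf
  refine mem_endAr_of_X_pow fun i => mem_endAr_iff.1 hf _ ?_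
  rw [← Nat.add_sub_cancel' hrs, pow_add, pow_mul]
  exact pow_mem (Algebra.subset_adjoin (Set.mem_range_self i)) _

theorem mulLeft_mem_endAr {k : Type*} [Field k] {n p r : ℕ} (b : MvPolynomial (Fin n) k) :
    LinearMap.mulLeft k b ∈ endAr k n p r :=
  mem_endAr_iff.2 fun c _ a => by simp [mul_left_comm]

theorem dividedPower_mem_endAr {k : Type*} [Field k] {p : ℕ} [CharP k p] (hp : p.Prime)
    {n r s : ℕ} (hs : s < p ^ r) (i : Fin n) : dividedPower k n i s ∈ endAr k n p r := by
  refine mem_endAr_of_X_pow fun j a => ?_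
  suffices h : dividedPower k n i s ∘ₗ LinearMap.mulLeft k (MvPolynomial.X j ^ p ^ r) =
      LinearMap.mulLeft k (MvPolynomial.X j ^ p ^ r) ∘ₗ dividedPower k n i s from
    LinearMap.congr_fun h a
  refine (MvPolynomial.basisMonomials (Fin n) k).ext fun m => ?_
  simp only [MvPolynomial.coe_basisMonomials, LinearMap.comp_apply, LinearMap.mulLeft_apply,
    MvPolynomial.X_pow_eq_monomial, MvPolynomial.monomial_mul, one_mul, dividedPower_monomial,
    mul_smul_comm]
  obtain rfl | hij := eq_or_ne j i
  · simp only [Finsupp.add_apply, Finsupp.single_eq_same, cast_choose_add_pow_char hp hs]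
    by_cases hm : m j < s
    · simp [Nat.choose_eq_zero_of_lt hm]
    · rw [add_tsub_assoc_of_le (Finsupp.single_le_iff.2 (not_lt.1 hm))]
  · have hsub : Finsupp.single j (p ^ r) + m - Finsupp.single i s =
        Finsupp.single j (p ^ r) + (m - Finsupp.single i s) := by
      ext l
      by_cases hl : l = i
      · subst hl; simp [hij]
      · simp [Finsupp.single_apply, Ne.symm hl]
    rw [hsub]
    simp [hij]

theorem mulLeft_mem_weylAlgebra {k : Type*} [Field k] {n : ℕ} (b : MvPolynomial (Fin n) k) :
    LinearMap.mulLeft k b ∈ weylAlgebra k n := by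
  change Algebra.lmul k (MvPolynomial (Fin n) k) b ∈ weylAlgebra k n
  induction b using MvPolynomial.induction_on with
  | C c =>
    rw [← MvPolynomial.algebraMap_eq, AlgHom.commutes]
    exact Subalgebra.algebraMap_mem _ c
  | add x y hx hy => rw [map_add]; exact add_mem hx hy
  | mul_X x i hx =>
    rw [map_mul]
    exact mul_mem hx (Algebra.subset_adjoin (Or.inl ⟨i, rfl⟩))

theorem dividedPower_mem_weylAlgebra {k : Type*} [Field k] {n : ℕ} (i : Fin n) (s : ℕ) :
    dividedPower k n i s ∈ weylAlgebra k n := by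
  obtain rfl | hs := Nat.eq_zero_or_pos s
  · convert one_mem (weylAlgebra k n)
    refine (MvPolynomial.basisMonomials (Fin n) k).ext fun m => ?_
    simp [dividedPower_monomial]
  · exact Algebra.subset_adjoin (Or.inr ⟨i, s, hs, rfl⟩)

/-- An element of `End_{A_r}(A)` is determined by its values on the monomials with all exponents
less than `p ^ r`. -/
theorem endAr_ext {k : Type*} [Field k] {n p r : ℕ} (hp : 0 < p)
    {f g : Module.End k (MvPolynomial (Fin n) k)} (hf : f ∈ endAr k n p r)
    (hg : g ∈ endAr k n p r)
    (h : ∀ m : Fin n →₀ ℕ, (∀ i, m i < p ^ r) →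
      f (MvPolynomial.monomial m 1) = g (MvPolynomial.monomial m 1)) : f = g := by
  refine (MvPolynomial.basisMonomials (Fin n) k).ext fun m => ?_
  have hm : (MvPolynomial.monomial m 1 : MvPolynomial (Fin n) k) =
      (∏ i, (MvPolynomial.X i ^ p ^ r) ^ (m i / p ^ r)) *
        MvPolynomial.monomial (m.mapRange (· % p ^ r) (Nat.zero_mod _)) 1 := by
    rw [MvPolynomial.monomial_eq, MvPolynomial.monomial_eq,
      Finsupp.prod_fintype _ _ (by simp), Finsupp.prod_fintype _ _ (by simp)]
    simp only [map_one, one_mul, ← Finset.prod_mul_distrib, Finsupp.mapRange_apply, ← pow_mul,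
      ← pow_add, Nat.div_add_mod]
  have hb : ∏ i, (MvPolynomial.X i ^ p ^ r) ^ (m i / p ^ r) ∈ subAr k n p r :=
    prod_mem fun i _ => pow_mem (Algebra.subset_adjoin (Set.mem_range_self i)) _
  rw [MvPolynomial.coe_basisMonomials]
  dsimp only
  rw [hm, mem_endAr_iff.1 hf _ hb, mem_endAr_iff.1 hg _ hb,
    h _ fun i => Nat.mod_lt _ (pow_pos hp r)]

/-- The Weyl algebra contains, for each exponent `m` with entries less than `p ^ r`, the
`A_r`-linear coordinate form at `x^m` of the basis of such monomials of `A` over `A_r`. -/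
theorem exists_coordinate_mem_weylAlgebra {k : Type*} [Field k] {p : ℕ} [CharP k p]
    (hp : p.Prime) {n : ℕ} (r : ℕ) (m : Fin n →₀ ℕ) (hm : ∀ i, m i < p ^ r) :
    ∃ e ∈ weylAlgebra k n, e ∈ endAr k n p r ∧
      ∀ m' : Fin n →₀ ℕ, (∀ i, m' i < p ^ r) →
        e (MvPolynomial.monomial m' 1) = if m' = m then 1 else 0 := by
  have hq : 0 < p ^ r := pow_pos hp.pos r
  let t : Fin n →₀ ℕ := Finsupp.equivFunOnFinite.symm fun _ => p ^ r - 1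
  have hti : ∀ i, t i = p ^ r - 1 := fun i => rfl
  refine ⟨((List.finRange n).map fun i => dividedPower k n i (p ^ r - 1)).prod *
    LinearMap.mulLeft k (MvPolynomial.monomial (t - m) 1), ?_, ?_, fun m' hm' => ?_⟩
  · refine mul_mem (list_prod_mem fun x hx => ?_) (mulLeft_mem_weylAlgebra _)
    obtain ⟨i, -, rfl⟩ := List.mem_map.1 hx
    exact dividedPower_mem_weylAlgebra i _
  · refine mul_mem (list_prod_mem fun x hx => ?_) (mulLeft_mem_endAr _)
    obtain ⟨i, -, rfl⟩ := List.mem_map.1 hx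
    exact dividedPower_mem_endAr hp (by omega) i
  · rw [Module.End.mul_apply, LinearMap.mulLeft_apply, MvPolynomial.monomial_mul, one_mul,
      list_prod_dividedPower_monomial k n _ _ (List.nodup_finRange n)]
    split_ifs with h
    · subst h
      have hsum : ((List.finRange n).map fun i => Finsupp.single i (p ^ r - 1)).sum = t := by
        rw [← List.ofFn_eq_map, List.sum_ofFn]
        ext j
        simp [Finsupp.finsetSum_apply, Finsupp.single_apply, hti, -Finsupp.single_tsub]
      have hadd : t - m' + m' = t :=
        tsub_add_cancel_of_le fun i => by have := hm' i; rw [hti]; omega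
      simp [hsum, hadd, hti, -Finsupp.single_tsub]
    · obtain ⟨i, hi⟩ := DFunLike.ne_iff.1 h
      rw [List.prod_eq_zero, zero_smul]
      refine List.mem_map.2 ⟨i, List.mem_finRange i, ?_⟩
      have h1 := hm i
      have h2 := hm' i
      rw [Finsupp.add_apply, Finsupp.tsub_apply, hti]
      rcases lt_or_gt_of_ne hi with hlt | hgt
      · rw [Nat.choose_eq_zero_of_lt (by omega), Nat.cast_zero]
      · rw [show p ^ r - 1 - m i + m' i = p ^ r + (m' i - m i - 1) by omega,
          cast_choose_add_pow_char hp (by omega), Nat.choose_eq_zero_of_lt (by omega),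
          Nat.cast_zero]

theorem endAr_le_weylAlgebra {k : Type*} [Field k] {p : ℕ} [CharP k p] (hp : p.Prime) (n r : ℕ)
    {f : Module.End k (MvPolynomial (Fin n) k)} (hf : f ∈ endAr k n p r) :
    f ∈ weylAlgebra k n := by
  let box : Finset (Fin n →₀ ℕ) :=
    Finset.Iic (Finsupp.equivFunOnFinite.symm fun _ => p ^ r - 1)
  have hq : 0 < p ^ r := pow_pos hp.pos r
  have hbox : ∀ m, m ∈ box ↔ ∀ i, m i < p ^ r := fun m => by
    simp only [box, Finset.mem_Iic, Finsupp.le_def]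
    exact forall_congr' fun i => (Nat.lt_iff_le_pred hq).symm
  choose! e he_weyl he_end he using
    fun m (hm : m ∈ box) => exists_coordinate_mem_weylAlgebra (k := k) hp r m ((hbox m).1 hm)
  have hfe : f = ∑ m ∈ box, LinearMap.mulLeft k (f (MvPolynomial.monomial m 1)) * e m := by
    refine endAr_ext hp.pos hf
      (sum_mem fun m hm => mul_mem (mulLeft_mem_endAr _) (he_end m hm)) fun m' hm' => ?_
    rw [LinearMap.sum_apply, Finset.sum_eq_single m']
    · simp [he m' ((hbox m').2 hm') m' hm']
    · intro m hm hne
      simp [he m hm m' hm', hne.symm]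
    · exact fun h => absurd ((hbox m').2 hm') h
  rw [hfe]
  exact sum_mem fun m hm => mul_mem (mulLeft_mem_weylAlgebra _) (he_weyl m hm)

theorem exists_mem_endAr_of_mem_weylAlgebra {k : Type*} [Field k] {p : ℕ} [CharP k p]
    (hp : p.Prime) {n : ℕ} {f : Module.End k (MvPolynomial (Fin n) k)}
    (hf : f ∈ weylAlgebra k n) : ∃ r, f ∈ endAr k n p r := by
  induction hf using Algebra.adjoin_induction with
  | mem x hx =>
    rcases hx with ⟨i, rfl⟩ | ⟨i, s, -, rfl⟩
    · exact ⟨0, mulLeft_mem_endAr _⟩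
    · exact ⟨s, dividedPower_mem_endAr hp (Nat.lt_pow_self hp.one_lt) i⟩
  | algebraMap c =>
    exact ⟨0, mem_endAr_iff.2 fun b _ a => by simp [Module.algebraMap_end_apply]⟩
  | add x y _ _ hx hy =>
    obtain ⟨r, hr⟩ := hx
    obtain ⟨s, hs⟩ := hy
    exact ⟨max r s, add_mem (endAr_mono k n p (le_max_left r s) hr)
      (endAr_mono k n p (le_max_right r s) hs)⟩
  | mul x y _ _ hx hy =>
    obtain ⟨r, hr⟩ := hx
    obtain ⟨s, hs⟩ := hy
    exact ⟨max r s, mul_mem (endAr_mono k n p (le_max_left r s) hr)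
      (endAr_mono k n p (le_max_right r s) hs)⟩

/-- The union `⋃_{r ≥ 0} End_{A_r}(A)`, taken inside `End_k(A)`, equals the Weyl algebra
`A_n(k)`. -/
theorem iUnion_endAr_eq_weylAlgebra (k : Type*) [Field k] (p : ℕ) (hp : 0 < p) [CharP k p]
    (n : ℕ) (hn : 1 ≤ n) :
    (⋃ r : ℕ, (endAr k n p r : Set (Module.End k (MvPolynomial (Fin n) k)))) =
      (weylAlgebra k n : Set (Module.End k (MvPolynomial (Fin n) k))) := by
  have hprime : p.Prime := (CharP.char_is_prime_or_zero k p).resolve_right hp.ne'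
  ext f
  simp only [Set.mem_iUnion, SetLike.mem_coe]
  exact ⟨fun ⟨r, hr⟩ => endAr_le_weylAlgebra hprime n r hr,
    exists_mem_endAr_of_mem_weylAlgebra hprime⟩
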